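/- Assume conditions (9) and (11). Then the series S(P) is a K-linear combination of multiple zeta values ζ(s_1, …, s_q) satisfying all of the following: 0 ≤ q ≤ p; s_1 ≥ 2 (when q ≥ 1); there exist indices 1 ≤ i_1 < … < i_q ≤ p with 1 ≤ s_ℓ ≤ A_{i_ℓ} for every ℓ ∈ {1, …, q}; and the number of ℓ ∈ {1, …, q} with s_ℓ = 1 is at most the number of i ∈ {1, …, p} with deg_{k_i} P ≥ A_i(n_i+1) − 1. -/

import Mathlib

/-- The multiple zeta value `ζ(s₁, …, s_q)`, defined as a sum over strictly
decreasing tuples `k₁ > k₂ > … > k_q ≥ 1`.  For the empty list it equals `1`. -/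
noncomputable def mzv (s : List ℕ) : ℝ :=
  ∑' k : {k : Fin s.length → ℕ // StrictAnti k ∧ ∀ i, 1 ≤ k i},
    ∏ i : Fin s.length, ((k.1 i : ℝ) ^ s.get i)⁻¹

/-- The rational function `P(k₁,…,k_p) / ∏ᵢ ((kᵢ+rᵢ)_{nᵢ+1})^{Aᵢ}`. -/
noncomputable def Rfun (p : ℕ) (K : Subfield ℂ) (A n r : ℕ → ℕ)
    (P : MvPolynomial (Fin p) K) (k : Fin p → ℂ) : ℂ :=
  MvPolynomial.eval₂ K.subtype k P /
    ∏ i : Fin p, ((ascPochhammer ℂ (n i.1 + 1)).eval (k i + (r i.1 : ℂ))) ^ A i.1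

open Filter Topology Finset

section NestedSums

/-- The function `(x + a)⁻ˢ` of the variable `x = n + 1`. -/
noncomputable def pole (a s : ℕ) : ℕ → ℂ := fun n => ((n : ℂ) + 1 + a)⁻¹ ^ s

/-- The variable `x = n + 1`, as a function of `n`. -/
def linVar : ℕ → ℂ := fun n => (n : ℂ) + 1

/-- The function `∏ (x + a)⁻¹` over the multiset `M`, in the variable `x = n + 1`. -/
noncomputable def poleProd (M : Multiset ℕ) : ℕ → ℂ := (M.map fun a => pole a 1).prod

/-- The truncated multiple zeta value, summed over `x > l₁ > l₂ > … ≥ 1` with `x = n + 1`. -/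
noncomputable def truncMZV : List ℕ → ℕ → ℂ
  | [] => fun _ => 1
  | s :: w => fun n => ∑ i ∈ range n, pole 0 s i * truncMZV w i

lemma truncMZV_cons_zero (s : ℕ) (w : List ℕ) : truncMZV (s :: w) 0 = 0 := by simp [truncMZV]

lemma truncMZV_cons_succ (s : ℕ) (w : List ℕ) (n : ℕ) :
    truncMZV (s :: w) (n + 1) = truncMZV (s :: w) n + pole 0 s n * truncMZV w n := by
  simp [truncMZV, sum_range_succ]

lemma cast_add_ne_zero (n a : ℕ) : (n : ℂ) + 1 + a ≠ 0 := by
  exact_mod_cast (by omega : n + 1 + a ≠ 0)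

lemma pole_mul_pole_same (a s t : ℕ) : pole a s * pole a t = pole a (s + t) := by
  ext n; simp [pole, pow_add]

lemma pole_succ_apply (a s n : ℕ) : pole a s (n + 1) = pole (a + 1) s n := by
  simp only [pole]; push_cast; ring_nf

lemma poleProd_cons (a : ℕ) (M : Multiset ℕ) : poleProd (a ::ₘ M) = pole a 1 * poleProd M := by
  simp [poleProd]

lemma poleProd_add (M N : Multiset ℕ) : poleProd (M + N) = poleProd M * poleProd N := by
  simp [poleProd]

lemma poleProd_replicate (a s : ℕ) : poleProd (Multiset.replicate s a) = pole a s := by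
  ext n; simp [poleProd, pole]

lemma linVar_mul_pole (a : ℕ) : linVar * pole a 1 = 1 - (a : ℕ → ℂ) * pole a 1 := by
  ext n
  have := cast_add_ne_zero n a
  simp only [linVar, pole, Pi.mul_apply, Pi.sub_apply, Pi.one_apply, Pi.natCast_apply]
  field_simp
  ring

lemma linVar_pow_mul_pole_self (t : ℕ) : linVar ^ t * pole 0 t = 1 := by
  ext n
  have := cast_add_ne_zero n 0
  simp only [linVar, pole, Pi.mul_apply, Pi.pow_apply, Pi.one_apply]
  simp only [Nat.cast_zero, add_zero] at this ⊢
  rw [← mul_pow, mul_inv_cancel₀ this, one_pow]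

lemma linVar_pow_mul_pole_of_le {d t : ℕ} (h : t ≤ d) :
    linVar ^ d * pole 0 t = linVar ^ (d - t) := by
  obtain ⟨e, rfl⟩ := Nat.exists_eq_add_of_le h
  rw [Nat.add_sub_cancel_left, pow_add]
  linear_combination linVar ^ e * linVar_pow_mul_pole_self t

lemma linVar_pow_mul_pole_of_ge {d t : ℕ} (h : d ≤ t) :
    linVar ^ d * pole 0 t = pole 0 (t - d) := by
  obtain ⟨e, rfl⟩ := Nat.exists_eq_add_of_le h
  rw [Nat.add_sub_cancel_left, ← pole_mul_pole_same]
  linear_combination pole 0 e * linVar_pow_mul_pole_self d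

/-- Words dominated, letter by letter, by a sublist of `B`, with positive letters. -/
def Adm (B w : List ℕ) : Prop := List.SublistForall₂ (fun s a => 1 ≤ s ∧ s ≤ a) w B

lemma Adm.nil {B : List ℕ} : Adm B [] := List.SublistForall₂.nil

lemma Adm.cons_right {B w : List ℕ} {a : ℕ} (h : Adm B w) : Adm (a :: B) w :=
  List.SublistForall₂.cons_right h

lemma Adm.cons {B w : List ℕ} {a s : ℕ} (h1 : 1 ≤ s) (h2 : s ≤ a) (h : Adm B w) :
    Adm (a :: B) (s :: w) :=
  List.SublistForall₂.cons ⟨h1, h2⟩ h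

lemma Adm.sublist {B u w : List ℕ} (h : Adm B w) (huw : u.Sublist w) : Adm B u := by
  induction h generalizing u with
  | nil => rw [List.sublist_nil.1 huw]; exact Adm.nil
  | cons hab _ ih =>
    cases huw with
    | cons _ h => exact (ih h).cons_right
    | cons_cons _ h => exact Adm.cons hab.1 hab.2 (ih h)
  | cons_right _ ih => exact (ih huw).cons_right

lemma Adm.tail {B w : List ℕ} {s : ℕ} (h : Adm B (s :: w)) : Adm B w :=
  h.sublist (List.sublist_cons_self s w)

lemma Adm.head_le {B w : List ℕ} {s t : ℕ} (h : Adm B (s :: w)) (h1 : 1 ≤ t) (h2 : t ≤ s) :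
    Adm B (t :: w) := by
  generalize hv : s :: w = v at h
  induction h with
  | nil => simp at hv
  | cons hab h _ =>
    obtain ⟨rfl, rfl⟩ := List.cons.inj hv
    exact Adm.cons h1 (h2.trans hab.2) h
  | cons_right _ ih => exact (ih hv).cons_right

lemma Adm.one_le {B w : List ℕ} (h : Adm B w) : ∀ s ∈ w, 1 ≤ s := by
  induction h with
  | nil => simp
  | cons hab _ ih => simpa using ⟨hab.1, by simpa using ih⟩
  | cons_right _ ih => exact ih

variable {K : Type*} [Field K] [Algebra K ℂ]

variable (K) in
/-- The `K`-linear map `f ↦ (n ↦ ∑_{i ≤ n} f i * z i)`. -/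
noncomputable def sumMul (z : ℕ → ℂ) : (ℕ → ℂ) →ₗ[K] (ℕ → ℂ) where
  toFun f := fun n => ∑ i ∈ range (n + 1), f i * z i
  map_add' f g := by ext n; simp [add_mul, sum_add_distrib]
  map_smul' c f := by ext n; simp [smul_sum]

lemma map_mem_of_mem_span {S : Set (ℕ → ℂ)} {V : Submodule K (ℕ → ℂ)}
    (T : (ℕ → ℂ) →ₗ[K] (ℕ → ℂ)) (h : ∀ g ∈ S, T g ∈ V) {f : ℕ → ℂ}
    (hf : f ∈ Submodule.span K S) : T f ∈ V :=
  (Submodule.span_le.2 h : Submodule.span K S ≤ V.comap T) hf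

/-! ### Partial fractions -/

/-- Simple fractions whose pole orders are bounded by multiplicities in `M`. -/
def properParts (M : Multiset ℕ) : Set (ℕ → ℂ) :=
  {f | ∃ a s, a ∈ M ∧ 1 ≤ s ∧ s ≤ M.count a ∧ f = pole a s}

/-- Spanning set for the fractions with denominator `M` and degree at most `-2`. -/
def decayingParts (M : Multiset ℕ) : Set (ℕ → ℂ) :=
  {f | ∃ a s, a ∈ M ∧ 2 ≤ s ∧ s ≤ M.count a ∧ f = pole a s} ∪
  {f | ∃ a b, a ∈ M ∧ b ∈ M ∧ f = pole a 1 - pole b 1}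

lemma properParts_mono {M N : Multiset ℕ} (h : M ≤ N) : properParts M ⊆ properParts N := by
  rintro _ ⟨a, s, ha, h1, h2, rfl⟩
  exact ⟨a, s, Multiset.mem_of_le h ha, h1, h2.trans (Multiset.count_le_of_le a h), rfl⟩

lemma decayingParts_mono {M N : Multiset ℕ} (h : M ≤ N) : decayingParts M ⊆ decayingParts N := by
  rintro _ (⟨a, s, ha, h1, h2, rfl⟩ | ⟨a, b, ha, hb, rfl⟩)
  · exact Or.inl ⟨a, s, Multiset.mem_of_le h ha, h1, h2.trans (Multiset.count_le_of_le a h), rfl⟩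
  · exact Or.inr ⟨a, b, Multiset.mem_of_le h ha, Multiset.mem_of_le h hb, rfl⟩

lemma pole_mul_pole {a b : ℕ} (hab : a ≠ b) :
    pole a 1 * pole b 1 = ((b : K) - a)⁻¹ • (pole a 1 - pole b 1) := by
  have hK : (algebraMap K ℂ) ((b : K) - a)⁻¹ = ((b : ℂ) - a)⁻¹ := by simp
  ext n
  have h1 := cast_add_ne_zero n a
  have h2 := cast_add_ne_zero n b
  have h3 : (b : ℂ) - a ≠ 0 := sub_ne_zero.2 (by exact_mod_cast hab.symm)
  rw [Pi.smul_apply, Algebra.smul_def, hK]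
  simp only [pole, Pi.mul_apply, Pi.sub_apply, pow_one]
  field_simp
  ring

lemma eq_replicate_or_eq_cons_cons (M : Multiset ℕ) (hM : M ≠ 0) :
    (∃ a, M = Multiset.replicate M.card a) ∨ ∃ a b N, a ≠ b ∧ M = a ::ₘ b ::ₘ N := by
  obtain ⟨a, ha⟩ := Multiset.exists_mem_of_ne_zero hM
  by_cases h : ∀ b ∈ M, b = a
  · exact Or.inl ⟨a, Multiset.eq_replicate.2 ⟨rfl, h⟩⟩
  · push Not at h
    obtain ⟨b, hb, hba⟩ := h
    obtain ⟨N, rfl⟩ := Multiset.exists_cons_of_mem ha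
    obtain ⟨N', rfl⟩ := Multiset.exists_cons_of_mem ((Multiset.mem_cons.1 hb).resolve_left hba)
    exact Or.inr ⟨a, b, N', hba.symm, rfl⟩

lemma poleProd_cons_cons {a b : ℕ} (hab : a ≠ b) (N : Multiset ℕ) :
    poleProd (a ::ₘ b ::ₘ N) =
      ((b : K) - a)⁻¹ • (poleProd (a ::ₘ N) - poleProd (b ::ₘ N)) := by
  simp only [poleProd_cons]
  rw [← mul_assoc, pole_mul_pole (K := K) hab, ← sub_mul, smul_mul_assoc]

lemma poleProd_mem_properParts (M : Multiset ℕ) (hM : M ≠ 0) :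
    poleProd M ∈ Submodule.span K (properParts M) := by
  induction M using Multiset.strongInductionOn with
  | ih M ih =>
  obtain ⟨a, ha⟩ | ⟨a, b, N, hab, rfl⟩ := eq_replicate_or_eq_cons_cons M hM
  · refine Submodule.subset_span ?_
    have hc : M.card ≠ 0 := by simpa using hM
    refine ⟨a, M.card, ?_, by omega, ?_, ?_⟩
    · rw [ha]; exact Multiset.mem_replicate.2 ⟨hc, rfl⟩
    · conv_rhs => rw [ha, Multiset.count_replicate_self]
    · conv_lhs => rw [ha]
      exact poleProd_replicate _ _
  · rw [poleProd_cons_cons (K := K) hab]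
    have h1 : a ::ₘ N < a ::ₘ b ::ₘ N := (Multiset.cons_lt_cons_iff).2 (Multiset.lt_cons_self _ _)
    have h2 : b ::ₘ N < a ::ₘ b ::ₘ N := Multiset.lt_cons_self _ _
    exact Submodule.smul_mem _ _ (Submodule.sub_mem _
      (Submodule.span_mono (properParts_mono h1.le) (ih _ h1 (by simp)))
      (Submodule.span_mono (properParts_mono h2.le) (ih _ h2 (by simp))))

lemma poleProd_mem_decayingParts (M : Multiset ℕ) (hM : 2 ≤ M.card) :
    poleProd M ∈ Submodule.span K (decayingParts M) := by
  induction M using Multiset.strongInductionOn with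
  | ih M ih =>
  have hM0 : M ≠ 0 := by rintro rfl; simp at hM
  obtain ⟨a, ha⟩ | ⟨a, b, N, hab, rfl⟩ := eq_replicate_or_eq_cons_cons M hM0
  · refine Submodule.subset_span (Or.inl ⟨a, M.card, ?_, hM, ?_, ?_⟩)
    · rw [ha]; exact Multiset.mem_replicate.2 ⟨by omega, rfl⟩
    · conv_rhs => rw [ha, Multiset.count_replicate_self]
    · conv_lhs => rw [ha]
      exact poleProd_replicate _ _
  · rw [poleProd_cons_cons (K := K) hab]
    refine Submodule.smul_mem _ _ ?_
    by_cases hN : N = 0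
    · subst hN
      refine Submodule.subset_span (Or.inr ⟨a, b, by simp, by simp, ?_⟩)
      simp [poleProd]
    have hc : 1 ≤ N.card := Multiset.card_pos.2 hN
    have h1 : a ::ₘ N < a ::ₘ b ::ₘ N := (Multiset.cons_lt_cons_iff).2 (Multiset.lt_cons_self _ _)
    have h2 : b ::ₘ N < a ::ₘ b ::ₘ N := Multiset.lt_cons_self _ _
    exact Submodule.sub_mem _
      (Submodule.span_mono (decayingParts_mono h1.le) (ih _ h1 (by simp; omega)))
      (Submodule.span_mono (decayingParts_mono h2.le) (ih _ h2 (by simp; omega)))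

lemma linVar_pow_succ_mul_poleProd_cons (m a : ℕ) (M : Multiset ℕ) :
    linVar ^ (m + 1) * poleProd (a ::ₘ M) =
      linVar ^ m * poleProd M - (a : K) • (linVar ^ m * poleProd (a ::ₘ M)) := by
  have : (a : K) • (linVar ^ m * poleProd (a ::ₘ M)) =
      (a : ℕ → ℂ) * (linVar ^ m * poleProd (a ::ₘ M)) := by
    rw [Algebra.smul_def]; simp
  rw [this, poleProd_cons, pow_succ]
  linear_combination linVar ^ m * poleProd M * linVar_mul_pole a

lemma linVar_pow_mul_poleProd_mem (m : ℕ) (M : Multiset ℕ) :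
    linVar ^ m * poleProd M ∈ Submodule.span K
      ({f | ∃ d, d + M.card ≤ m ∧ f = linVar ^ d} ∪ properParts M) := by
  induction m generalizing M with
  | zero =>
    rcases eq_or_ne M 0 with rfl | hM
    · exact Submodule.subset_span (Or.inl ⟨0, by simp, by simp [poleProd]⟩)
    · rw [pow_zero, one_mul]
      exact Submodule.span_mono Set.subset_union_right (poleProd_mem_properParts M hM)
  | succ m ih =>
    induction M using Multiset.induction_on with
    | empty => exact Submodule.subset_span (Or.inl ⟨m + 1, by simp, by simp [poleProd]⟩)
    | cons a M _ =>
      rw [linVar_pow_succ_mul_poleProd_cons (K := K)]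
      refine Submodule.sub_mem _ (Submodule.span_mono (Set.union_subset_union ?_ ?_) (ih M))
        (Submodule.smul_mem _ _ (Submodule.span_mono (Set.union_subset_union ?_ subset_rfl) (ih _)))
      · rintro _ ⟨d, hd, rfl⟩
        exact ⟨d, by simp; omega, rfl⟩
      · exact properParts_mono (Multiset.le_cons_self _ _)
      · rintro _ ⟨d, hd, rfl⟩
        exact ⟨d, by omega, rfl⟩

lemma linVar_pow_mul_poleProd_mem_decayingParts (m : ℕ) (M : Multiset ℕ) (h : m + 2 ≤ M.card) :
    linVar ^ m * poleProd M ∈ Submodule.span K (decayingParts M) := by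
  induction m generalizing M with
  | zero =>
    rw [pow_zero, one_mul]
    exact poleProd_mem_decayingParts M (by omega)
  | succ m ih =>
    induction M using Multiset.induction_on with
    | empty => simp at h
    | cons a M _ =>
      rw [linVar_pow_succ_mul_poleProd_cons (K := K)]
      rw [Multiset.card_cons] at h
      exact Submodule.sub_mem _
        (Submodule.span_mono (decayingParts_mono (Multiset.le_cons_self _ _)) (ih M (by omega)))
        (Submodule.smul_mem _ _ (ih _ (by rw [Multiset.card_cons]; omega)))

/-! ### Spaces stable under summation -/

/-- Products of a simple fraction and a truncated multiple zeta value. -/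
def boundaryTerms (B : List ℕ) (β n : ℕ) : Set (ℕ → ℂ) :=
  {f | ∃ a s w, a < β ∧ Adm B (s :: w) ∧ w.count 1 ≤ n ∧ f = pole a s * truncMZV w}

/-- Truncations of convergent multiple zeta values. -/
def convergentTerms (B : List ℕ) (n : ℕ) : Set (ℕ → ℂ) :=
  {f | ∃ w, Adm B w ∧ w.count 1 ≤ n ∧ (w ≠ [] → 2 ≤ w.headI) ∧ f = truncMZV w}

/-- All truncations of multiple zeta values. -/
def truncTerms (B : List ℕ) (n : ℕ) : Set (ℕ → ℂ) :=
  {f | ∃ w, Adm B w ∧ w.count 1 ≤ n ∧ f = truncMZV w}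

/-- Products of a monomial and a truncated multiple zeta value. -/
def monomialTerms (B : List ℕ) (n D : ℕ) : Set (ℕ → ℂ) :=
  {f | ∃ d w, d ≤ D ∧ Adm B w ∧ w.count 1 + 1 ≤ n ∧ f = linVar ^ d * truncMZV w}

variable (K) in
/-- The span of the terms having a limit in the span of multiple zeta values. -/
def convSpan (B : List ℕ) (β n : ℕ) : Submodule K (ℕ → ℂ) :=
  Submodule.span K (boundaryTerms B β n ∪ convergentTerms B n)

variable (K) in
/-- The span of the terms of polynomial growth of order at most `D`. -/
def growthSpan (B : List ℕ) (β n D : ℕ) : Submodule K (ℕ → ℂ) :=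
  Submodule.span K (boundaryTerms B β n ∪ truncTerms B n ∪ monomialTerms B n D)

lemma convSpan_le_growthSpan (B : List ℕ) (β n D : ℕ) :
    convSpan K B β n ≤ growthSpan K B β n D := by
  refine Submodule.span_mono ?_
  rintro f (hf | ⟨w, h1, h2, -, rfl⟩)
  · exact Or.inl (Or.inl hf)
  · exact Or.inl (Or.inr ⟨w, h1, h2, rfl⟩)

lemma growthSpan_mono {B : List ℕ} {β n D D' : ℕ} (h : D ≤ D') :
    growthSpan K B β n D ≤ growthSpan K B β n D' := by
  refine Submodule.span_mono (Set.union_subset_union subset_rfl ?_)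
  rintro _ ⟨d, w, h1, h2, h3, rfl⟩
  exact ⟨d, w, h1.trans h, h2, h3, rfl⟩

section Summation

variable {B : List ℕ} {β n : ℕ}

lemma pole_mul_truncMZV_mem {a s : ℕ} {w : List ℕ} (ha : a < β) (hs : Adm B (s :: w))
    (hn : w.count 1 ≤ n) : pole a s * truncMZV w ∈ convSpan K B β n :=
  Submodule.subset_span (Or.inl ⟨a, s, w, ha, hs, hn, rfl⟩)

lemma truncMZV_mem {w : List ℕ} (hw : Adm B w) (hn : w.count 1 ≤ n)
    (h2 : w ≠ [] → 2 ≤ w.headI) : truncMZV w ∈ convSpan K B β n :=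
  Submodule.subset_span (Or.inr ⟨w, hw, hn, h2, rfl⟩)

lemma sumMul_shift_nil (g : ℕ → ℂ) :
    sumMul K (truncMZV []) (fun i => g (i + 1) - g i) =
      (fun i => g (i + 1)) * truncMZV [] - (fun _ => g 0) * truncMZV [] := by
  ext N
  simp [sumMul, truncMZV, -sum_sub_distrib, sum_range_sub]

lemma sumMul_shift_cons (g : ℕ → ℂ) (t : ℕ) (w : List ℕ) :
    sumMul K (truncMZV (t :: w)) (fun i => g (i + 1) - g i) =
      (fun i => g (i + 1)) * truncMZV (t :: w)
        + (fun i => g (i + 1)) * pole 0 t * truncMZV w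
        - sumMul K (truncMZV w) ((fun i => g (i + 1)) * pole 0 t) := by
  ext N
  simp only [sumMul, LinearMap.coe_mk, AddHom.coe_mk, Pi.add_apply, Pi.sub_apply, Pi.mul_apply]
  induction N with
  | zero =>
    simp [truncMZV_cons_zero]
  | succ N ih =>
    rw [sum_range_succ, ih, sum_range_succ (n := N + 1), truncMZV_cons_succ t w N]
    ring

lemma pole_shift_eq (a s : ℕ) :
    pole (a + 1) s - pole a s = fun i => pole a s (i + 1) - pole a s i := by
  ext i; simp [pole_succ_apply]

lemma count_tail_le (t : ℕ) (w : List ℕ) : w.count 1 ≤ (t :: w).count 1 :=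
  (List.sublist_cons_self t w).count_le 1

lemma pole_mul_pole_mul_truncMZV_mem {a s t : ℕ} {w : List ℕ} (ha : a < β) (ha0 : a ≠ 0)
    (hs : Adm B (s :: w)) (ht : Adm B (t :: w)) (hn : w.count 1 ≤ n) :
    pole a s * pole 0 t * truncMZV w ∈ convSpan K B β n := by
  have hs1 : 1 ≤ s := hs.one_le s (by simp)
  have h := poleProd_mem_properParts (K := K)
    (Multiset.replicate s a + Multiset.replicate t 0) (by
      intro h
      have := congrArg Multiset.card h
      simp at this
      omega)
  rw [poleProd_add, poleProd_replicate, poleProd_replicate] at h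
  refine map_mem_of_mem_span (LinearMap.mulRight K (truncMZV w)) ?_ h
  rintro _ ⟨b, u, hb, hu1, hu2, rfl⟩
  rw [Multiset.count_add, Multiset.count_replicate, Multiset.count_replicate] at hu2
  rw [LinearMap.mulRight_apply]
  rcases Multiset.mem_add.1 hb with hb | hb
  · obtain rfl := Multiset.eq_of_mem_replicate hb
    rw [if_pos rfl, if_neg (Ne.symm ha0), add_zero] at hu2
    exact pole_mul_truncMZV_mem ha (hs.head_le hu1 hu2) hn
  · obtain rfl := Multiset.eq_of_mem_replicate hb
    rw [if_pos rfl, if_neg ha0, zero_add] at hu2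
    exact pole_mul_truncMZV_mem (by omega) (ht.head_le hu1 hu2) hn

lemma sumMul_pole_zero (s : ℕ) (w : List ℕ) :
    sumMul K (truncMZV w) (pole 0 s) = truncMZV (s :: w) + pole 0 s * truncMZV w := by
  ext N
  simp [sumMul, truncMZV, sum_range_succ]

lemma sumMul_mem_of_shift {w : List ℕ} (hn : w.count 1 ≤ n)
    (shift : ∀ a s, a + 1 < β → Adm B (s :: w) →
      sumMul K (truncMZV w) (pole (a + 1) s - pole a s) ∈ convSpan K B β n)
    (m : ℕ) (M : Multiset ℕ) (hM : m + 2 ≤ M.card)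
    (h : ∀ a ∈ M, a < β ∧ Adm B (M.count a :: w)) :
    sumMul K (truncMZV w) (linVar ^ m * poleProd M) ∈ convSpan K B β n := by
  have diff : ∀ a s, a < β → Adm B (s :: w) →
      sumMul K (truncMZV w) (pole a s - pole 0 s) ∈ convSpan K B β n := by
    intro a s ha hs
    induction a with
    | zero => simp
    | succ a ih =>
      have := Submodule.add_mem _ (shift a s ha hs) (ih (by omega))
      rwa [← map_add, sub_add_sub_cancel] at this
  refine map_mem_of_mem_span _ ?_ (linVar_pow_mul_poleProd_mem_decayingParts m M hM)
  rintro _ (⟨a, s, ha, h1, h2, rfl⟩ | ⟨a, b, ha, hb, rfl⟩)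
  · obtain ⟨haβ, hA⟩ := h a ha
    have hs := hA.head_le (by omega) h2
    rw [← sub_add_cancel (pole a s) (pole 0 s), map_add, sumMul_pole_zero]
    refine Submodule.add_mem _ (diff a s haβ hs) (Submodule.add_mem _ ?_ ?_)
    · refine truncMZV_mem hs ?_ (by simpa using h1)
      rwa [List.count_cons_of_ne (by omega)]
    · exact pole_mul_truncMZV_mem (by omega) hs hn
  · have key : ∀ c ∈ M, sumMul K (truncMZV w) (pole c 1 - pole 0 1) ∈ convSpan K B β n :=
      fun c hc => diff c 1 (h c hc).1
        ((h c hc).2.head_le le_rfl (Multiset.one_le_count_iff_mem.2 hc))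
    have := Submodule.sub_mem _ (key a ha) (key b hb)
    rwa [← map_sub, sub_sub_sub_cancel_right] at this

lemma sumMul_shift_and_decaying (w : List ℕ) (hn : w.count 1 ≤ n) :
    (∀ a s, a + 1 < β → Adm B (s :: w) →
      sumMul K (truncMZV w) (pole (a + 1) s - pole a s) ∈ convSpan K B β n) ∧
    ∀ m M, m + 2 ≤ M.card → (∀ a ∈ M, a < β ∧ Adm B (M.count a :: w)) →
      sumMul K (truncMZV w) (linVar ^ m * poleProd M) ∈ convSpan K B β n := by
  induction w with
  | nil =>
    have shift : ∀ a s, a + 1 < β → Adm B [s] →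
        sumMul K (truncMZV []) (pole (a + 1) s - pole a s) ∈ convSpan K B β n := by
      intro a s ha hs
      rw [pole_shift_eq, sumMul_shift_nil]
      simp only [pole_succ_apply]
      refine Submodule.sub_mem _ (pole_mul_truncMZV_mem ha hs hn) ?_
      have : (fun _ => pole a s 0) * truncMZV [] = ((1 + (a : K))⁻¹ ^ s) • truncMZV [] := by
        ext N; simp [pole, Algebra.smul_def]
      rw [this]
      exact Submodule.smul_mem _ _ (truncMZV_mem Adm.nil hn (by simp))
    exact ⟨shift, sumMul_mem_of_shift hn shift⟩
  | cons t w ih =>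
    have hn' := (count_tail_le t w).trans hn
    have shift : ∀ a s, a + 1 < β → Adm B (s :: t :: w) →
        sumMul K (truncMZV (t :: w)) (pole (a + 1) s - pole a s) ∈ convSpan K B β n := by
      intro a s ha hs
      have hsw : Adm B (s :: w) := hs.sublist (by simp)
      have htw : Adm B (t :: w) := hs.tail
      have hs1 : 1 ≤ s := hs.one_le s (by simp)
      have ht1 : 1 ≤ t := hs.one_le t (by simp)
      rw [pole_shift_eq, sumMul_shift_cons]
      simp only [pole_succ_apply]
      refine Submodule.sub_mem _ (Submodule.add_mem _ (pole_mul_truncMZV_mem ha hs hn)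
        (pole_mul_pole_mul_truncMZV_mem ha (by omega) hsw htw hn')) ?_
      have := (ih hn').2 0 (Multiset.replicate s (a + 1) + Multiset.replicate t 0)
        (by simp; omega) (by
          intro b hb
          rw [Multiset.count_add, Multiset.count_replicate, Multiset.count_replicate]
          rcases Multiset.mem_add.1 hb with hb | hb
          · obtain rfl := Multiset.eq_of_mem_replicate hb
            simpa using ⟨ha, hsw⟩
          · obtain rfl := Multiset.eq_of_mem_replicate hb
            simpa using ⟨by omega, htw⟩)
      rwa [poleProd_add, poleProd_replicate, poleProd_replicate, pow_zero, one_mul] at this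
    exact ⟨shift, sumMul_mem_of_shift hn shift⟩

lemma sumMul_decaying_mem {w : List ℕ} (hn : w.count 1 ≤ n) {m : ℕ} {M : Multiset ℕ}
    (hM : m + 2 ≤ M.card) (h : ∀ a ∈ M, a < β ∧ Adm B (M.count a :: w)) :
    sumMul K (truncMZV w) (linVar ^ m * poleProd M) ∈ convSpan K B β n :=
  (sumMul_shift_and_decaying w hn).2 m M hM h

lemma sumMul_pole_mem {w : List ℕ} (hn : w.count 1 + 1 ≤ n) {a s : ℕ} (ha : a < β)
    (hs : Adm B (s :: w)) (D : ℕ) :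
    sumMul K (truncMZV w) (pole a s) ∈ growthSpan K B β n D := by
  have hn' : w.count 1 ≤ n := by omega
  induction a with
  | zero =>
    rw [sumMul_pole_zero]
    refine Submodule.add_mem _ (Submodule.subset_span (Or.inl (Or.inr ⟨_, hs, ?_, rfl⟩)))
      (convSpan_le_growthSpan _ _ _ _ (pole_mul_truncMZV_mem ha hs hn'))
    rw [List.count_cons]
    split_ifs <;> omega
  | succ a ih =>
    rw [← sub_add_cancel (pole (a + 1) s) (pole a s), map_add]
    exact Submodule.add_mem _ (convSpan_le_growthSpan _ _ _ _
      ((sumMul_shift_and_decaying w hn').1 a s ha hs)) (ih (by omega))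

lemma linVar_pow_mul_truncMZV_mem {w : List ℕ} (hw : Adm B w) (hn : w.count 1 + 1 ≤ n)
    {d D : ℕ} (hd : d ≤ D) : linVar ^ d * truncMZV w ∈ growthSpan K B β n D :=
  Submodule.subset_span (Or.inr ⟨d, w, hd, hw, hn, rfl⟩)

lemma exists_linVar_pow_diff (m : ℕ) : ∃ c : ℕ → K,
    (fun i : ℕ => (((i + 1 : ℕ) : ℂ)) ^ (m + 1) - (i : ℂ) ^ (m + 1)) =
      ((m + 1 : ℕ) : K) • linVar ^ m + ∑ j ∈ range m, c j • linVar ^ j := by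
  refine ⟨fun j => -((-1) ^ (m + 1 - j) * ((m + 1).choose j : K)), ?_⟩
  ext i
  have h : (i : ℂ) ^ (m + 1) = (((i : ℂ) + 1) + (-1)) ^ (m + 1) := by ring
  rw [h, add_pow, sum_range_succ, sum_range_succ]
  simp only [Pi.add_apply, Finset.sum_apply, Pi.smul_apply, Pi.pow_apply, linVar]
  simp only [Algebra.smul_def, map_neg, map_mul, map_pow, map_one, map_natCast]
  have hs : ∑ j ∈ range m, -((-1 : ℂ) ^ (m + 1 - j) * ((m + 1).choose j : ℂ)) * ((i : ℂ) + 1) ^ j =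
      -∑ j ∈ range m, ((i : ℂ) + 1) ^ j * (-1) ^ (m + 1 - j) * ((m + 1).choose j : ℂ) := by
    rw [← sum_neg_distrib]
    exact sum_congr rfl fun j _ => by ring
  rw [hs]
  simp
  ring

lemma sumMul_linVar_pow_mem [CharZero K] (hβ : 0 < β) {w : List ℕ} (hw : Adm B w)
    (hn : w.count 1 + 1 ≤ n) (m : ℕ) :
    sumMul K (truncMZV w) (linVar ^ m) ∈ growthSpan K B β n (m + 1) := by
  have reduce : ∀ w : List ℕ, (∀ m, sumMul K (truncMZV w)
      (fun i : ℕ => (((i + 1 : ℕ) : ℂ)) ^ (m + 1) - (i : ℂ) ^ (m + 1)) ∈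
        growthSpan K B β n (m + 1)) →
      ∀ m, sumMul K (truncMZV w) (linVar ^ m) ∈ growthSpan K B β n (m + 1) := by
    intro w h m
    induction m using Nat.strong_induction_on with
    | _ m ih =>
      obtain ⟨c, hc⟩ := exists_linVar_pow_diff (K := K) m
      have h1 := h m
      rw [hc, map_add, map_smul, map_sum] at h1
      refine (Submodule.smul_mem_iff _ (Nat.cast_ne_zero.2 m.succ_ne_zero : ((m + 1 : ℕ) : K) ≠ 0)).1
        ((Submodule.add_mem_iff_left _ (Submodule.sum_mem _ fun j hj => ?_)).1 h1)
      rw [map_smul]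
      have hjm := mem_range.1 hj
      exact Submodule.smul_mem _ _ (growthSpan_mono (by omega) (ih j hjm))
  have hlin : ∀ m : ℕ, (fun i : ℕ => (((i + 1 : ℕ) : ℂ)) ^ (m + 1)) = linVar ^ (m + 1) := by
    intro m; ext i; simp [linVar]
  induction w generalizing m with
  | nil =>
    refine reduce _ (fun m => ?_) m
    rw [sumMul_shift_nil (fun i : ℕ => (i : ℂ) ^ (m + 1)), hlin]
    refine Submodule.sub_mem _ (linVar_pow_mul_truncMZV_mem hw hn le_rfl) ?_
    have : (fun _ : ℕ => ((0 : ℕ) : ℂ) ^ (m + 1)) * truncMZV [] = 0 := by ext; simp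
    rw [this]
    exact Submodule.zero_mem _
  | cons t w ih =>
    have ht1 : 1 ≤ t := hw.one_le t (by simp)
    have hn' : w.count 1 + 1 ≤ n := by have := count_tail_le t w; omega
    refine reduce _ (fun m => ?_) m
    rw [sumMul_shift_cons (fun i : ℕ => (i : ℂ) ^ (m + 1)), hlin]
    refine Submodule.sub_mem _ (Submodule.add_mem _
      (linVar_pow_mul_truncMZV_mem hw hn le_rfl) ?_) ?_
    · rcases le_or_gt t (m + 1) with h | h
      · rw [linVar_pow_mul_pole_of_le h]
        exact linVar_pow_mul_truncMZV_mem hw.tail hn' (by omega)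
      · rw [linVar_pow_mul_pole_of_ge h.le]
        exact convSpan_le_growthSpan _ _ _ _
          (pole_mul_truncMZV_mem hβ (hw.head_le (by omega) (by omega)) (by omega))
    · rcases le_or_gt t (m + 1) with h | h
      · rw [linVar_pow_mul_pole_of_le h]
        exact growthSpan_mono (by omega) (ih hw.tail hn' _)
      · rw [linVar_pow_mul_pole_of_ge h.le]
        exact sumMul_pole_mem hn' hβ (hw.head_le (by omega) (by omega)) _

lemma sumMul_growth_mem [CharZero K] (hβ : 0 < β) {w : List ℕ} (hw : Adm B w)
    (hn : w.count 1 + 1 ≤ n) {m D : ℕ} {M : Multiset ℕ} (hM : m + 1 ≤ M.card + D)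
    (h : ∀ a ∈ M, a < β ∧ Adm B (M.count a :: w)) :
    sumMul K (truncMZV w) (linVar ^ m * poleProd M) ∈ growthSpan K B β n D := by
  refine map_mem_of_mem_span _ ?_ (linVar_pow_mul_poleProd_mem m M)
  rintro _ (⟨d, hd, rfl⟩ | ⟨a, s, ha, h1, h2, rfl⟩)
  · exact growthSpan_mono (by omega) (sumMul_linVar_pow_mem hβ hw hn d)
  · exact sumMul_pole_mem hn (h a ha).1 ((h a ha).2.head_le h1 h2) _

end Summation

/-! ### Iterated sums -/

/-- Poles, with multiplicity, of `((x + r)_{n+1})^{-A}`. -/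
def slotPoles (A n r : ℕ) : Multiset ℕ := A • (Multiset.range (n + 1)).map (r + ·)

/-- The function `x^m / ((x + r)_{n+1})^A` of the variable `x`. -/
noncomputable def slot (A n r m : ℕ) : ℕ → ℂ := linVar ^ m * poleProd (slotPoles A n r)

lemma card_slotPoles (A n r : ℕ) : (slotPoles A n r).card = A * (n + 1) := by
  simp [slotPoles]

lemma mem_slotPoles {A n r b : ℕ} (h : b ∈ slotPoles A n r) :
    r ≤ b ∧ b < r + n + 1 ∧ 1 ≤ A ∧ (slotPoles A n r).count b = A := by
  have hA : A ≠ 0 := by rintro rfl; simp [slotPoles] at h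
  have hb : b ∈ (Multiset.range (n + 1)).map (r + ·) := Multiset.mem_of_mem_nsmul h
  have hnd : ((Multiset.range (n + 1)).map (r + ·)).Nodup :=
    (Multiset.nodup_range _).map (add_right_injective r)
  obtain ⟨l, hl, rfl⟩ := Multiset.mem_map.1 hb
  rw [Multiset.mem_range] at hl
  refine ⟨by omega, by omega, by omega, ?_⟩
  rw [slotPoles, Multiset.count_nsmul, Multiset.count_eq_one_of_mem hnd hb, mul_one]

lemma sumMul_comm (f g : ℕ → ℂ) : sumMul K f g = sumMul K g f := by
  ext; simp [sumMul, mul_comm]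

lemma sumMul_mul (f g h : ℕ → ℂ) : sumMul K (f * g) h = sumMul K g (h * f) := by
  ext; simp [sumMul, mul_assoc]

section Slot

variable {B : List ℕ} {β n A n₀ r m D : ℕ}

lemma slotPoles_add_adm (hβ : β ≤ r) {w : List ℕ} (hw : Adm B w) {M : Multiset ℕ}
    (hM : ∀ a ∈ M, a < β ∧ Adm B (M.count a :: w)) :
    ∀ a ∈ slotPoles A n₀ r + M,
      a < r + n₀ + 1 ∧ Adm (A :: B) ((slotPoles A n₀ r + M).count a :: w) := by
  intro a ha
  rw [Multiset.count_add]
  by_cases hs : a ∈ slotPoles A n₀ r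
  · obtain ⟨h1, h2, h3, h4⟩ := mem_slotPoles hs
    have : a ∉ M := fun h => by have := (hM a h).1; omega
    rw [h4, Multiset.count_eq_zero_of_notMem this, add_zero]
    exact ⟨h2, Adm.cons h3 le_rfl hw⟩
  · obtain ⟨h1, h2⟩ := hM a ((Multiset.mem_add.1 ha).resolve_left hs)
    rw [Multiset.count_eq_zero_of_notMem hs, zero_add]
    exact ⟨by omega, h2.cons_right⟩

lemma sumMul_slot_mem {V : Submodule K (ℕ → ℂ)}
    (h : ∀ d M w, d ≤ D → (∀ a ∈ M, a < β ∧ Adm B (M.count a :: w)) → Adm B w →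
      w.count 1 ≤ n → (d = 0 ∨ w.count 1 + 1 ≤ n) →
      sumMul K (truncMZV w) (linVar ^ (m + d) * poleProd (slotPoles A n₀ r + M)) ∈ V)
    {f : ℕ → ℂ} (hf : f ∈ growthSpan K B β n D) : sumMul K f (slot A n₀ r m) ∈ V := by
  have key : ∀ d M w, sumMul K (slot A n₀ r m) (linVar ^ d * poleProd M * truncMZV w) =
      sumMul K (truncMZV w) (linVar ^ (m + d) * poleProd (slotPoles A n₀ r + M)) := by
    intro d M w
    rw [sumMul_comm, sumMul_mul, slot, pow_add, poleProd_add]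
    congr 1
    ring
  rw [sumMul_comm]
  refine map_mem_of_mem_span _ ?_ hf
  rintro _ ((⟨a, s, w, ha, hs, hn, rfl⟩ | ⟨w, hw, hn, rfl⟩) | ⟨d, w, hd, hw, hn, rfl⟩)
  · have := h 0 (Multiset.replicate s a) w (by omega) (by
      intro b hb
      obtain rfl := Multiset.eq_of_mem_replicate hb
      simpa using ⟨ha, hs⟩) hs.tail hn (Or.inl rfl)
    rwa [← key, poleProd_replicate, pow_zero, one_mul] at this
  · have := h 0 0 w (by omega) (by simp) hw hn (Or.inl rfl)
    rwa [← key, show poleProd 0 = 1 by simp [poleProd], pow_zero, one_mul, one_mul] at this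
  · have := h d 0 w hd (by simp) hw (by omega) (Or.inr hn)
    rwa [← key, show poleProd 0 = 1 by simp [poleProd], mul_one] at this

lemma sumMul_slot_mem_convSpan (hβ : β ≤ r) (hm : m + D + 2 ≤ A * (n₀ + 1)) {f : ℕ → ℂ}
    (hf : f ∈ growthSpan K B β n D) :
    sumMul K f (slot A n₀ r m) ∈ convSpan K (A :: B) (r + n₀ + 1) n := by
  refine sumMul_slot_mem (fun d M w hd hM hw hn _ => ?_) hf
  refine sumMul_decaying_mem hn ?_ (slotPoles_add_adm hβ hw hM)
  rw [Multiset.card_add, card_slotPoles]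
  omega

lemma sumMul_slot_mem_growthSpan [CharZero K] (hβ : β ≤ r) {f : ℕ → ℂ}
    (hf : f ∈ growthSpan K B β n D) :
    sumMul K f (slot A n₀ r m) ∈ growthSpan K (A :: B) (r + n₀ + 1)
      (n + if A * (n₀ + 1) ≤ m + 1 then 1 else 0) (m + 1 + D - A * (n₀ + 1)) := by
  refine sumMul_slot_mem (fun d M w hd hM hw hn hd0 => ?_) hf
  have hadm := slotPoles_add_adm (A := A) (n₀ := n₀) hβ hw hM
  have hcard : (slotPoles A n₀ r + M).card = A * (n₀ + 1) + M.card := by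
    rw [Multiset.card_add, card_slotPoles]
  by_cases hc : w.count 1 + 1 ≤ n + if A * (n₀ + 1) ≤ m + 1 then 1 else 0
  · exact sumMul_growth_mem (by omega) hw.cons_right hc (by omega) hadm
  · split_ifs at hc ⊢ with h
    · omega
    · exact convSpan_le_growthSpan _ _ _ _ (sumMul_decaying_mem hn (by omega) hadm)

end Slot

/-- Sum of `∏ i, f i (k i)` over `N > k 0 ≥ k 1 + c ≥ …`. -/
noncomputable def chainSum (c : ℕ) : (p : ℕ) → (Fin p → ℕ → ℂ) → ℕ → ℂ
  | 0, _ => fun _ => 1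
  | p + 1, f => fun N => ∑ a ∈ range N, f 0 a * chainSum c p (fun i => f i.succ) (a + 1 - c)

lemma chainSum_zero_succ (p : ℕ) (f : Fin (p + 1) → ℕ → ℂ) :
    (fun N => chainSum 0 (p + 1) f (N + 1)) =
      sumMul K (fun N => chainSum 0 p (fun i => f i.succ) (N + 1)) (f 0) := by
  ext N; simp [chainSum, sumMul]

/-- Exponent of the polynomial growth of the iterated sum of fractions with numerators of degrees
`m i` and denominators of degrees `c i`. -/
def growthDeg : ℕ → (ℕ → ℕ) → (ℕ → ℕ) → ℕ
  | 0, _, _ => 0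
  | p + 1, c, m => m 0 + 1 + growthDeg p (fun i => c (i + 1)) (fun i => m (i + 1)) - c 0

lemma add_growthDeg_le (p : ℕ) (c m : ℕ → ℕ) (y z : ℕ)
    (h : ∀ j ≤ p, y + ∑ i ∈ range j, (m i + 1) ≤ z + ∑ i ∈ range j, c i) :
    y + growthDeg p c m ≤ z := by
  induction p generalizing c m y z with
  | zero => simpa [growthDeg] using h 0 le_rfl
  | succ p ih =>
    have h0 := h 0 (by omega)
    have h1 := ih (fun i => c (i + 1)) (fun i => m (i + 1)) (y + (m 0 + 1)) (z + c 0) (by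
      intro j hj
      have := h (j + 1) (by omega)
      rw [sum_range_succ', sum_range_succ'] at this
      omega)
    simp only [range_zero, sum_empty, add_zero] at h0
    simp only [growthDeg]
    omega

lemma exists_chainSum_mem_growthSpan [CharZero K] (p : ℕ) (A n r m : ℕ → ℕ)
    (hr : ∀ i, i + 1 < p → r (i + 1) + n (i + 1) + 1 ≤ r i) :
    ∃ β, (∀ x, (0 < p → r 0 + n 0 + 1 ≤ x) → β ≤ x) ∧
    (fun N => chainSum 0 p (fun i => slot (A i) (n i) (r i) (m i)) (N + 1)) ∈
      growthSpan K (List.ofFn fun i : Fin p => A i) β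
        (Nat.count (fun i => A i * (n i + 1) ≤ m i + 1) p)
        (growthDeg p (fun i => A i * (n i + 1)) m) := by
  induction p generalizing A n r m with
  | zero =>
    refine ⟨0, by simp, Submodule.subset_span (Or.inl (Or.inr ⟨[], Adm.nil, by simp, ?_⟩))⟩
    ext; simp [chainSum, truncMZV]
  | succ p ih =>
    obtain ⟨β, hβ, hf⟩ := ih (fun i => A (i + 1)) (fun i => n (i + 1)) (fun i => r (i + 1))
      (fun i => m (i + 1)) (fun i hi => hr (i + 1) (by omega))
    refine ⟨r 0 + n 0 + 1, fun x hx => hx (by omega), ?_⟩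
    have := sumMul_slot_mem_growthSpan (A := A 0) (n₀ := n 0) (r := r 0) (m := m 0)
      (hβ (r 0) (fun hp => hr 0 (by omega))) hf
    rw [chainSum_zero_succ (K := K), List.ofFn_succ, Nat.count_succ', growthDeg]
    simpa using this

lemma exists_chainSum_mem_convSpan [CharZero K] (p : ℕ) (A n r m : ℕ → ℕ)
    (hr : ∀ i, i + 1 < p + 1 → r (i + 1) + n (i + 1) + 1 ≤ r i)
    (hd : ∀ j ≤ p, ∑ i ∈ range (j + 1), m i + j + 2 ≤
      ∑ i ∈ range (j + 1), A i * (n i + 1)) :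
    ∃ β, (fun N => chainSum 0 (p + 1) (fun i => slot (A i) (n i) (r i) (m i)) (N + 1)) ∈
      convSpan K (List.ofFn fun i : Fin (p + 1) => A i) β
        (Nat.count (fun i => A i * (n i + 1) ≤ m i + 1) (p + 1)) := by
  obtain ⟨β, hβ, hf⟩ := exists_chainSum_mem_growthSpan (K := K) p (fun i => A (i + 1))
    (fun i => n (i + 1)) (fun i => r (i + 1)) (fun i => m (i + 1))
    (fun i hi => hr (i + 1) (by omega))
  have h0 : m 0 + 2 ≤ A 0 * (n 0 + 1) := by simpa using hd 0 (by omega)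
  have hD := add_growthDeg_le p (fun i => A (i + 1) * (n (i + 1) + 1)) (fun i => m (i + 1))
    (m 0 + 2) (A 0 * (n 0 + 1)) (by
      intro j hj
      have := hd j hj
      rw [sum_range_succ', sum_range_succ'] at this
      rw [sum_add_distrib, sum_const, card_range, smul_eq_mul, mul_one]
      omega)
  refine ⟨r 0 + n 0 + 1, ?_⟩
  have := sumMul_slot_mem_convSpan (A := A 0) (n₀ := n 0) (r := r 0) (m := m 0)
    (hβ (r 0) (fun hp => hr 0 (by omega))) (by omega) hf
  rw [chainSum_zero_succ (K := K), List.ofFn_succ, Nat.count_succ',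
    if_neg (by omega), add_zero]
  simpa using this

/-! ### Limits -/

lemma norm_pole (a s n : ℕ) : ‖pole a s n‖ = (((n : ℝ) + 1 + a)⁻¹) ^ s := by
  have : ((n : ℂ) + 1 + a) = (((n : ℝ) + 1 + a : ℝ) : ℂ) := by push_cast; rfl
  rw [pole, this, norm_pow, norm_inv, Complex.norm_of_nonneg (by positivity)]

lemma norm_pole_le {a s t : ℕ} (h : t ≤ s) (n : ℕ) : ‖pole a s n‖ ≤ (((n : ℝ) + 1)⁻¹) ^ t := by
  rw [norm_pole]
  have h1 : ((n : ℝ) + 1 + a)⁻¹ ≤ ((n : ℝ) + 1)⁻¹ :=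
    inv_anti₀ (by positivity) (by linarith [Nat.cast_nonneg (α := ℝ) a])
  have h2 : ((n : ℝ) + 1)⁻¹ ≤ 1 := inv_le_one_of_one_le₀ (by linarith [Nat.cast_nonneg (α := ℝ) n])
  calc (((n : ℝ) + 1 + a)⁻¹) ^ s ≤ (((n : ℝ) + 1)⁻¹) ^ s := by gcongr
    _ ≤ _ := pow_le_pow_of_le_one (by positivity) h2 h

lemma norm_truncMZV_le {w : List ℕ} (hw : ∀ s ∈ w, 1 ≤ s) (n : ℕ) :
    ‖truncMZV w n‖ ≤ 3 ^ w.length * √((n : ℝ) + 1) := by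
  induction w generalizing n with
  | nil =>
    simp only [truncMZV, norm_one, List.length_nil, pow_zero, one_mul]
    exact Real.one_le_sqrt.2 (by linarith [Nat.cast_nonneg (α := ℝ) n])
  | cons s w ih =>
    have ih' := ih (fun t ht => hw t (List.mem_cons_of_mem s ht))
    induction n with
    | zero => rw [truncMZV_cons_zero, norm_zero]; positivity
    | succ n ihn =>
      have hx : (0 : ℝ) < (n : ℝ) + 1 := by positivity
      set x : ℝ := (n : ℝ) + 1
      have hstep : x⁻¹ * √x ≤ 3 * (√(x + 1) - √x) := by
        have h1 : 0 < √x := Real.sqrt_pos.2 hx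
        have h2 : √x * √x = x := Real.mul_self_sqrt hx.le
        have h3 : √(x + 1) * √(x + 1) = x + 1 := Real.mul_self_sqrt (by positivity)
        have h4 : √(x + 1) ≤ 2 * √x := by
          rw [Real.sqrt_le_left (by positivity)]
          have hx1 : 1 ≤ x := by simp [x]
          nlinarith
        have h5 : 0 ≤ √(x + 1) := Real.sqrt_nonneg _
        have h6 : x⁻¹ * √x = (√x)⁻¹ := by rw [inv_mul_eq_div, Real.sqrt_div_self]
        rw [h6, inv_le_iff_one_le_mul₀ h1]
        nlinarith
      rw [truncMZV_cons_succ]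
      have hp := norm_pole_le (a := 0) (hw s (by simp)) n
      rw [pow_one] at hp
      calc _ ≤ ‖truncMZV (s :: w) n‖ + ‖pole 0 s n‖ * ‖truncMZV w n‖ := by
            rw [← norm_mul]; exact norm_add_le _ _
        _ ≤ 3 ^ (w.length + 1) * √x + x⁻¹ * (3 ^ w.length * √x) := by
            gcongr
            · exact ihn
            · exact ih' n
        _ = 3 ^ (w.length + 1) * √x + 3 ^ w.length * (x⁻¹ * √x) := by ring
        _ ≤ 3 ^ (w.length + 1) * √x + 3 ^ w.length * (3 * (√(x + 1) - √x)) := by gcongr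
        _ = _ := by simp only [List.length_cons]; push_cast; ring

lemma tendsto_pole_mul_truncMZV {a s : ℕ} (hs : 1 ≤ s) {w : List ℕ} (hw : ∀ s ∈ w, 1 ≤ s) :
    Tendsto (pole a s * truncMZV w) atTop (𝓝 0) := by
  have hlim : Tendsto (fun n : ℕ => 3 ^ w.length * (√((n : ℝ) + 1))⁻¹) atTop (𝓝 0) := by
    rw [← mul_zero ((3 : ℝ) ^ w.length)]
    exact (tendsto_inv_atTop_zero.comp (Real.tendsto_sqrt_atTop.comp
      (tendsto_natCast_atTop_atTop.atTop_add tendsto_const_nhds))).const_mul _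
  refine squeeze_zero_norm (fun n => ?_) hlim
  have hx : (0 : ℝ) < (n : ℝ) + 1 := by positivity
  have h1 : 0 < √((n : ℝ) + 1) := Real.sqrt_pos.2 hx
  have h6 : ((n : ℝ) + 1)⁻¹ * √((n : ℝ) + 1) = (√((n : ℝ) + 1))⁻¹ := by
    rw [inv_mul_eq_div, Real.sqrt_div_self]
  rw [Pi.mul_apply, norm_mul]
  calc _ ≤ ((n : ℝ) + 1)⁻¹ * (3 ^ w.length * √((n : ℝ) + 1)) := by
        have := norm_pole_le (a := a) hs n
        rw [pow_one] at this
        gcongr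
        exact norm_truncMZV_le hw n
    _ = _ := by rw [← h6]; ring

lemma exists_tendsto_truncMZV {w : List ℕ} (hw : ∀ s ∈ w, 1 ≤ s) (h2 : w ≠ [] → 2 ≤ w.headI) :
    ∃ l, Tendsto (truncMZV w) atTop (𝓝 l) := by
  cases w with
  | nil => exact ⟨1, tendsto_const_nhds⟩
  | cons s w =>
    have hs : 2 ≤ s := h2 (by simp)
    have hsum : Summable fun i => pole 0 s i * truncMZV w i := by
      have h0 : Summable fun i : ℕ => 3 ^ w.length * (((i + 1 : ℕ) : ℝ) ^ (-(3 / 2) : ℝ)) :=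
        ((summable_nat_add_iff 1).2 (Real.summable_nat_rpow.2 (by norm_num))).mul_left _
      refine Summable.of_norm_bounded h0 (fun i => ?_)
      have hx : (0 : ℝ) < (i : ℝ) + 1 := by positivity
      rw [norm_mul]
      calc _ ≤ (((i : ℝ) + 1)⁻¹) ^ 2 * (3 ^ w.length * √((i : ℝ) + 1)) := by
            gcongr
            · exact norm_pole_le hs i
            · exact norm_truncMZV_le (fun t ht => hw t (List.mem_cons_of_mem s ht)) i
        _ = _ := by
            rw [Real.sqrt_eq_rpow, inv_pow, ← Real.rpow_natCast, ← Real.rpow_neg hx.le,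
              mul_left_comm, ← Real.rpow_add hx]
            push_cast
            norm_num
    exact ⟨_, hsum.hasSum.tendsto_sum_nat⟩

/-! ### Iterated sums as sums over chains -/

/-- The chains `N > k 0 ≥ k 1 + c ≥ …`. -/
def chainFinset (c p N : ℕ) : Finset (Fin p → ℕ) :=
  (Fintype.piFinset fun _ => range N).filter fun k => ∀ i j, i < j → k j + c ≤ k i

lemma mem_chainFinset {c p N : ℕ} {k : Fin p → ℕ} :
    k ∈ chainFinset c p N ↔ (∀ i, k i < N) ∧ ∀ i j, i < j → k j + c ≤ k i := by
  simp [chainFinset]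

lemma cons_mem_chainFinset {c p N a : ℕ} {k : Fin p → ℕ} :
    (Fin.cons a k : Fin (p + 1) → ℕ) ∈ chainFinset c (p + 1) N ↔
      a < N ∧ k ∈ chainFinset c p (a + 1 - c) := by
  simp only [mem_chainFinset, Fin.forall_fin_succ, Fin.cons_zero, Fin.cons_succ,
    Fin.succ_lt_succ_iff, Fin.succ_pos, Fin.not_lt_zero, forall_true_left,
    IsEmpty.forall_iff, true_and]
  constructor
  · rintro ⟨⟨h1, h2⟩, h3, h4⟩
    exact ⟨h1, fun i => by have := h3 i; omega, h4⟩
  · rintro ⟨h1, h2, h3⟩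
    exact ⟨⟨h1, fun i => by have := h2 i; omega⟩, fun i => by have := h2 i; omega, h3⟩

lemma sum_chainFinset (c p : ℕ) (f : Fin p → ℕ → ℂ) (N : ℕ) :
    ∑ k ∈ chainFinset c p N, ∏ i, f i (k i) = chainSum c p f N := by
  induction p generalizing N with
  | zero =>
    have : chainFinset c 0 N = {default} := by
      ext k
      simp [mem_chainFinset, Subsingleton.elim k default]
    rw [this]
    simp [chainSum]
  | succ p ih =>
    simp only [chainSum, ← ih, mul_sum]
    rw [sum_sigma']
    refine sum_nbij' (fun k => ⟨k 0, Fin.tail k⟩) (fun x => Fin.cons x.1 x.2) ?_ ?_ ?_ ?_ ?_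
    · intro k hk
      rw [← Fin.cons_self_tail k, cons_mem_chainFinset] at hk
      simpa using hk
    · rintro ⟨a, k⟩ hk
      exact cons_mem_chainFinset.2 (by simpa using hk)
    · intro k _
      exact Fin.cons_self_tail k
    · rintro ⟨a, k⟩ _
      simp
    · intro k _
      rw [Fin.prod_univ_succ]
      rfl

lemma hasSum_subtype_chain {c p : ℕ} {f : Fin p → ℕ → ℝ} (hf : ∀ i n, 0 ≤ f i n) {l : ℂ}
    (h : Tendsto (chainSum c p fun i n => (f i n : ℂ)) atTop (𝓝 l)) :
    HasSum (fun k : {k : Fin p → ℕ // ∀ i j, i < j → k j + c ≤ k i} =>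
      ((∏ i, f i (k.1 i) : ℝ) : ℂ)) l := by
  let b : ℕ → Finset {k : Fin p → ℕ // ∀ i j, i < j → k j + c ≤ k i} := fun N =>
    (chainFinset c p N).subtype _
  have hb : Tendsto b atTop atTop := by
    refine tendsto_atTop_finset_of_monotone ?_ ?_
    · intro N N' hN k hk
      simp only [b, mem_subtype, mem_chainFinset] at hk ⊢
      exact ⟨fun i => (hk.1 i).trans_le hN, hk.2⟩
    · intro k
      refine ⟨∑ i, k.1 i + 1, ?_⟩
      simp only [b, mem_subtype, mem_chainFinset]
      exact ⟨fun i => Nat.lt_succ_of_le (single_le_sum (fun _ _ => Nat.zero_le _) (mem_univ i)),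
        k.2⟩
  have hsum : ∀ N, ((∑ k ∈ b N, ∏ i, f i (k.1 i) : ℝ) : ℂ) =
      chainSum c p (fun i n => (f i n : ℂ)) N := by
    intro N
    rw [← sum_chainFinset, ← sum_subtype_of_mem (p := fun k => ∀ i j, i < j → k j + c ≤ k i) _
      (fun k hk => (mem_chainFinset.1 hk).2)]
    push_cast
    rfl
  have hre : Tendsto (fun N => ∑ k ∈ b N, ∏ i, f i (k.1 i)) atTop (𝓝 l.re) := by
    refine ((Complex.continuous_re.tendsto l).comp h).congr (fun N => ?_)
    rw [Function.comp_apply, ← hsum N, Complex.ofReal_re]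
  obtain ⟨C, hC⟩ := hre.bddAbove_range
  have hs : Summable fun k : {k : Fin p → ℕ // ∀ i j, i < j → k j + c ≤ k i} =>
      ∏ i, f i (k.1 i) := by
    refine summable_of_sum_le (c := C) (fun k => prod_nonneg fun i _ => hf i _) (fun u => ?_)
    obtain ⟨N, hN⟩ := (hb.eventually_ge_atTop u).exists
    exact (sum_le_sum_of_subset_of_nonneg hN fun k _ _ => prod_nonneg fun i _ => hf i _).trans
      (hC ⟨N, rfl⟩)
  have hH : HasSum _ _ := Complex.hasSum_ofReal.2 hs.hasSum
  have hl := tendsto_nhds_unique ((hH.comp hb).congr fun N => by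
    rw [Function.comp_apply, ← hsum N]; push_cast; rfl) h
  rwa [hl] at hH

lemma hasSum_chain {c p : ℕ} {Q : (Fin p → ℕ) → Prop}
    (hQ : ∀ k, Q k ↔ ∀ i j, i < j → k j + c ≤ k i)
    {f : Fin p → ℕ → ℝ} (hf : ∀ i n, 0 ≤ f i n) {l : ℂ}
    (h : Tendsto (chainSum c p fun i n => (f i n : ℂ)) atTop (𝓝 l)) :
    HasSum (fun k : {k : Fin p → ℕ // Q k ∧ ∀ i, 1 ≤ k i} =>
      ((∏ i, f i (k.1 i - 1) : ℝ) : ℂ)) l := by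
  let e : {k : Fin p → ℕ // ∀ i j, i < j → k j + c ≤ k i} ≃
      {k : Fin p → ℕ // Q k ∧ ∀ i, 1 ≤ k i} :=
    { toFun := fun k => ⟨fun i => k.1 i + 1,
        (hQ _).2 fun i j hij => by
          have := k.2 i j hij
          show k.1 j + 1 + c ≤ k.1 i + 1
          omega, fun i => Nat.le_add_left 1 _⟩
      invFun := fun k => ⟨fun i => k.1 i - 1, fun i j hij => by
        have := (hQ _).1 k.2.1 i j hij
        have := k.2.2 j
        show k.1 j - 1 + c ≤ k.1 i - 1
        omega⟩
      left_inv := fun k => by ext; simp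
      right_inv := fun k => by
        ext i
        exact Nat.sub_add_cancel (k.2.2 i) }
  rw [← e.hasSum_iff]
  exact hasSum_subtype_chain hf h

lemma chainSum_one_eq_truncMZV (w : List ℕ) :
    chainSum 1 w.length (fun i => pole 0 (w.get i)) = truncMZV w := by
  induction w with
  | nil => rfl
  | cons s w ih =>
    ext N
    simp only [truncMZV, ← ih, List.length_cons, chainSum]
    rfl

lemma tendsto_truncMZV {w : List ℕ} (hw : ∀ s ∈ w, 1 ≤ s) (h2 : w ≠ [] → 2 ≤ w.headI) :
    Tendsto (truncMZV w) atTop (𝓝 (mzv w : ℂ)) := by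
  obtain ⟨l, hl⟩ := exists_tendsto_truncMZV hw h2
  have h := hasSum_chain (c := 1) (Q := StrictAnti) (p := w.length)
    (f := fun i n => ((n : ℝ) + 1)⁻¹ ^ w.get i) (l := l)
    (fun k => Iff.rfl) (fun i n => by positivity) (by
      rw [← chainSum_one_eq_truncMZV] at hl
      refine hl.congr fun N => ?_
      congr 1
      ext i n
      simp [pole])
  have : (mzv w : ℂ) = l := by
    rw [← h.tsum_eq, mzv, Complex.ofReal_tsum]
    refine tsum_congr fun k => ?_
    congr 1
    refine prod_congr rfl fun i _ => ?_
    rw [Nat.cast_sub (k.2.2 i), Nat.cast_one, sub_add_cancel, inv_pow]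
  rwa [this]

/-- The words of the multiple zeta values arising as limits in `convSpan`. -/
def convWords (B : List ℕ) (n : ℕ) : Set (List ℕ) :=
  {w | Adm B w ∧ w.count 1 ≤ n ∧ (w ≠ [] → 2 ≤ w.headI)}

lemma exists_tendsto_of_mem_convSpan {B : List ℕ} {β n : ℕ} {f : ℕ → ℂ}
    (hf : f ∈ convSpan K B β n) :
    ∃ l ∈ Submodule.span K ((fun w => (mzv w : ℂ)) '' convWords B n),
      Tendsto f atTop (𝓝 l) := by
  induction hf using Submodule.span_induction with
  | mem f hf =>
    obtain ⟨a, s, w, -, hs, -, rfl⟩ | ⟨w, hw, hn, h2, rfl⟩ := hf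
    · exact ⟨0, Submodule.zero_mem _, tendsto_pole_mul_truncMZV (hs.one_le s (by simp))
        hs.tail.one_le⟩
    · exact ⟨_, Submodule.subset_span ⟨w, ⟨hw, hn, h2⟩, rfl⟩, tendsto_truncMZV hw.one_le h2⟩
  | zero => exact ⟨0, Submodule.zero_mem _, tendsto_const_nhds⟩
  | add f g _ _ hf hg =>
    obtain ⟨l, hl, hfl⟩ := hf
    obtain ⟨l', hl', hgl⟩ := hg
    exact ⟨l + l', Submodule.add_mem _ hl hl', hfl.add hgl⟩
  | smul c f _ hf =>
    obtain ⟨l, hl, hfl⟩ := hf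
    refine ⟨c • l, Submodule.smul_mem _ _ hl, ?_⟩
    have : c • f = fun n => algebraMap K ℂ c * f n := by
      ext; simp [Algebra.smul_def]
    rw [this, Algebra.smul_def]
    exact hfl.const_mul _

lemma poleProd_range_apply (n r x : ℕ) :
    poleProd ((Multiset.range n).map (r + ·)) x =
      ((ascPochhammer ℂ n).eval ((x : ℂ) + 1 + r))⁻¹ := by
  induction n with
  | zero => simp [poleProd]
  | succ n ih =>
    rw [Multiset.range_succ, Multiset.map_cons, poleProd_cons, Pi.mul_apply, ih,
      ascPochhammer_succ_eval, mul_inv, mul_comm, pole]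
    push_cast
    ring

lemma poleProd_nsmul (A : ℕ) (M : Multiset ℕ) : poleProd (A • M) = poleProd M ^ A := by
  simp [poleProd, Multiset.map_nsmul, Multiset.prod_nsmul]

lemma slot_apply (A n r m x : ℕ) : slot A n r m x =
    ((x : ℂ) + 1) ^ m / ((ascPochhammer ℂ (n + 1)).eval ((x : ℂ) + 1 + r)) ^ A := by
  rw [slot, slotPoles, poleProd_nsmul, Pi.mul_apply, Pi.pow_apply, Pi.pow_apply,
    poleProd_range_apply, inv_pow, linVar, div_eq_mul_inv]

lemma ofReal_norm_slot (A n r m x : ℕ) : ((‖slot A n r m x‖ : ℝ) : ℂ) = slot A n r m x := by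
  have : slot A n r m x =
      ((((x : ℝ) + 1) ^ m / (((ascPochhammer ℕ (n + 1)).eval (x + 1 + r) : ℕ) : ℝ) ^ A : ℝ) : ℂ) := by
    have h := ascPochhammer_eval_cast (S := ℂ) (n + 1) (x + 1 + r)
    push_cast at h
    rw [slot_apply, ← h, Complex.ofReal_div, Complex.ofReal_pow, Complex.ofReal_pow,
      Complex.ofReal_natCast]
    push_cast
    rfl
  rw [this, Complex.norm_of_nonneg (by positivity)]

lemma hasSum_monomial [CharZero K] (p : ℕ) (A n r m : ℕ → ℕ)
    (hr : ∀ i, i + 1 < p + 1 → r (i + 1) + n (i + 1) + 1 ≤ r i)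
    (hd : ∀ j ≤ p, ∑ i ∈ range (j + 1), m i + j + 2 ≤
      ∑ i ∈ range (j + 1), A i * (n i + 1)) :
    ∃ l ∈ Submodule.span K ((fun w => (mzv w : ℂ)) ''
        convWords (List.ofFn fun i : Fin (p + 1) => A i)
          (Nat.count (fun i => A i * (n i + 1) ≤ m i + 1) (p + 1))),
      HasSum (fun k : {k : Fin (p + 1) → ℕ // Antitone k ∧ ∀ i, 1 ≤ k i} =>
        ∏ i : Fin (p + 1), ((k.1 i : ℂ) ^ m i /
          ((ascPochhammer ℂ (n i + 1)).eval ((k.1 i : ℂ) + r i)) ^ A i)) l := by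
  obtain ⟨β, hβ⟩ := exists_chainSum_mem_convSpan (K := K) p A n r m hr hd
  obtain ⟨l, hl, hlim⟩ := exists_tendsto_of_mem_convSpan hβ
  refine ⟨l, hl, ?_⟩
  have h := hasSum_chain (c := 0) (Q := Antitone) (p := p + 1)
    (f := fun i x => ‖slot (A i) (n i) (r i) (m i) x‖) (l := l)
    (fun k => antitone_iff_forall_lt) (fun i x => norm_nonneg _) (by
      simp only [ofReal_norm_slot]
      exact (tendsto_add_atTop_iff_nat 1).1 hlim)
  refine h.congr_fun fun k => ?_
  push_cast
  refine prod_congr rfl fun i _ => ?_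
  rw [ofReal_norm_slot, slot_apply, Nat.cast_sub (k.2.2 i), Nat.cast_one, sub_add_cancel]

lemma Adm.exists_strictMono {p : ℕ} {A : ℕ → ℕ} {w : List ℕ}
    (h : Adm (List.ofFn fun i : Fin p => A i) w) :
    ∃ idx : Fin w.length → Fin p, StrictMono idx ∧
      ∀ l : Fin w.length, 1 ≤ w.get l ∧ w.get l ≤ A (idx l).1 := by
  obtain ⟨u, hu, hsub⟩ := List.sublistForall₂_iff.1 h
  obtain ⟨f, hf⟩ := List.sublist_iff_exists_fin_orderEmbedding_get_eq.1 hsub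
  have hlen := hu.length_eq
  refine ⟨fun i => Fin.cast (by simp) (f (Fin.cast hlen i)), fun i j hij => ?_, fun i => ?_⟩
  · exact f.strictMono hij
  · have h1 := hf (Fin.cast hlen i)
    have h2 := (List.forall₂_iff_get.1 hu).2 i i.2 (hlen ▸ i.2)
    simp only [List.get_ofFn] at h1
    rw [← show _ = A _ from h1]
    exact h2

end NestedSums

lemma sum_Iic_fin {p : ℕ} (j : Fin p) (g : ℕ → ℕ) :
    ∑ i ∈ Finset.Iic j, g i.1 = ∑ i ∈ range (j.1 + 1), g i := by
  have : range (j.1 + 1) = (Finset.Iic j).map Fin.valEmbedding := by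
    rw [Fin.map_valEmbedding_Iic]
    ext; simp
  rw [this, sum_map]
  rfl

lemma Rfun_eq_sum (p : ℕ) (K : Subfield ℂ) (A n r : ℕ → ℕ) (P : MvPolynomial (Fin p) K)
    (k : Fin p → ℂ) :
    Rfun p K A n r P k = ∑ d ∈ P.support, ((MvPolynomial.coeff d P : K) : ℂ) *
      ∏ i : Fin p, (k i ^ d i / ((ascPochhammer ℂ (n i + 1)).eval (k i + r i)) ^ A i) := by
  rw [Rfun, MvPolynomial.eval₂_eq', sum_div]
  refine sum_congr rfl fun d _ => ?_
  rw [prod_div_distrib, mul_div_assoc]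
  rfl

theorem statement1 (p : ℕ) (hp : 0 < p) (A n r : ℕ → ℕ) (K : Subfield ℂ)
    (P : MvPolynomial (Fin p) K)
    (h9 : ∀ j : Fin p, (∑ i ∈ Finset.Iic j, P.degreeOf i) + j.1 + 2 ≤
      ∑ i ∈ Finset.Iic j, A i.1 * (n i.1 + 1))
    (h11 : ∀ i : ℕ, i + 1 < p → r (i + 1) + n (i + 1) + 1 ≤ r i) :
    Summable (fun k : {k : Fin p → ℕ // Antitone k ∧ ∀ i, 1 ≤ k i} =>
        Rfun p K A n r P (fun i => (k.1 i : ℂ))) ∧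
    ∃ (T : Finset (List ℕ)) (c : List ℕ → K),
      (∀ s ∈ T, s.length ≤ p ∧ (s ≠ [] → 2 ≤ s.headI) ∧
        (∃ idx : Fin s.length → Fin p, StrictMono idx ∧
          ∀ l : Fin s.length, 1 ≤ s.get l ∧ s.get l ≤ A (idx l).1) ∧
        s.count 1 ≤ (Finset.univ.filter
          (fun i : Fin p => A i.1 * (n i.1 + 1) ≤ P.degreeOf i + 1)).card) ∧
      (∑' k : {k : Fin p → ℕ // Antitone k ∧ ∀ i, 1 ≤ k i},
          Rfun p K A n r P (fun i => (k.1 i : ℂ)))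
        = ∑ s ∈ T, (c s : ℂ) * (mzv s : ℂ) := by
  obtain ⟨p, rfl⟩ : ∃ q, p = q + 1 := ⟨p - 1, by omega⟩
  set N := (Finset.univ.filter
    (fun i : Fin (p + 1) => A i.1 * (n i.1 + 1) ≤ P.degreeOf i + 1)).card with hN
  set V : Submodule K ℂ := Submodule.span K ((fun w => (mzv w : ℂ)) ''
    convWords (List.ofFn fun i : Fin (p + 1) => A i) N)
  have hmono : ∀ d ∈ P.support, ∃ l ∈ V,
      HasSum (fun k : {k : Fin (p + 1) → ℕ // Antitone k ∧ ∀ i, 1 ≤ k i} =>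
        ∏ i : Fin (p + 1), ((k.1 i : ℂ) ^ d i /
          ((ascPochhammer ℂ (n i + 1)).eval ((k.1 i : ℂ) + r i)) ^ A i)) l := by
    intro d hd
    have hle : ∀ i, d i ≤ P.degreeOf i := fun i => MvPolynomial.monomial_le_degreeOf i hd
    let m : ℕ → ℕ := fun i => if h : i < p + 1 then d ⟨i, h⟩ else 0
    have hm : ∀ i : Fin (p + 1), m i = d i := fun i => dif_pos i.2
    obtain ⟨l, hl, hs⟩ := hasSum_monomial (K := K) p A n r m h11 (by
      intro j hj
      have h1 := h9 ⟨j, by omega⟩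
      have h2 : ∑ i ∈ Finset.Iic (⟨j, by omega⟩ : Fin (p + 1)), m i ≤
          ∑ i ∈ Finset.Iic (⟨j, by omega⟩ : Fin (p + 1)), P.degreeOf i :=
        sum_le_sum fun i _ => (hm i).trans_le (hle i)
      rw [sum_Iic_fin _ m] at h2
      rw [sum_Iic_fin _ fun i => A i * (n i + 1)] at h1
      simp only at h1 h2
      omega)
    simp only [hm] at hs
    refine ⟨l, ?_, hs⟩
    refine Submodule.span_mono (Set.image_mono ?_) hl
    rintro w ⟨h1, h2, h3⟩
    refine ⟨h1, h2.trans ?_, h3⟩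
    rw [Nat.count_eq_card_filter_range, hN, ← card_map Fin.valEmbedding]
    refine card_le_card fun i hi => ?_
    obtain ⟨hi1, hi2⟩ := mem_filter.1 hi
    have hip := mem_range.1 hi1
    refine mem_map.2 ⟨⟨i, hip⟩, mem_filter.2 ⟨mem_univ _, ?_⟩, rfl⟩
    exact hi2.trans (Nat.succ_le_succ ((hm ⟨i, hip⟩).trans_le (hle _)))
  choose! l hl hs using hmono
  have hsum : HasSum (fun k : {k : Fin (p + 1) → ℕ // Antitone k ∧ ∀ i, 1 ≤ k i} =>
      Rfun (p + 1) K A n r P (fun i => (k.1 i : ℂ)))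
      (∑ d ∈ P.support, ((MvPolynomial.coeff d P : K) : ℂ) * l d) := by
    simp only [Rfun_eq_sum]
    exact hasSum_sum fun d hd => (hs d hd).mul_left _
  refine ⟨hsum.summable, ?_⟩
  have hmem : ∑ d ∈ P.support, ((MvPolynomial.coeff d P : K) : ℂ) * l d ∈ V :=
    Submodule.sum_mem _ fun d hd => Submodule.smul_mem _ (MvPolynomial.coeff d P) (hl d hd)
  obtain ⟨c, hc, hcV⟩ := (Finsupp.mem_span_image_iff_linearCombination K).1 hmem
  refine ⟨c.support, c, fun w hw => ?_, ?_⟩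
  · obtain ⟨h1, h2, h3⟩ := (Finsupp.mem_supported K c).1 hc hw
    obtain ⟨idx, hidx, hA⟩ := h1.exists_strictMono
    exact ⟨by simpa using Fintype.card_le_of_injective idx hidx.injective, h3,
      ⟨idx, hidx, hA⟩, h2⟩
  · rw [hsum.tsum_eq, ← hcV, Finsupp.linearCombination_apply, Finsupp.sum]
    rfl
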